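/- Let Ψ : 𝒳 × 𝒫 → ℝ be a core. Then Ψ satisfies (B2) loss law invariance (Ψ(X|P) = Ψ(Y|P) whenever F_{X|P} = F_{Y|P}), (B4) ambiguity sensitivity (for all X ∈ 𝒳, P, Q ∈ 𝒫 and λ ∈ [0,1]: Ψ(X | λP + (1−λ)Q) ≥ λΨ(X|P) + (1−λ)Ψ(X|Q); and Ψ(1_A | λP + (1−λ)Q) = λΨ(1_A|P) + (1−λ)Ψ(1_A|Q) for every A ∈ 𝓕 with P(A) = Q(A)), and for every fixed P ∈ 𝒫 the map X ↦ Ψ(X|P) is monotone (X ≤ Y pointwise implies Ψ(X|P) ≤ Ψ(Y|P)), cash-additive (Ψ(X+m|P) = Ψ(X|P) + m for m ∈ ℝ), and comonotonic additive (Ψ(X+Y|P) = Ψ(X|P) + Ψ(Y|P) whenever X and Y are comonotonic), if and only if there exists an increasing concave function h : [0,1] → [0,1] with h(0) = 0 and h(1) = 1 such that Ψ(X|P) = ∫ X d(h∘P) for all X ∈ 𝒳 and P ∈ 𝒫. -/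

import Mathlib

open MeasureTheory Set

noncomputable section

/-- The uniform distribution on `[0,1]`. -/
def unif01 : Measure ℝ := volume.restrict (Icc (0:ℝ) 1)

/-- A probability measure is atomless (in the sense of the paper) if some measurable
real-valued map pushes it forward to the uniform distribution on `[0,1]`. -/
def IsAtomlessProb {Ω : Type*} [MeasurableSpace Ω] (P : Measure Ω) : Prop :=
  IsProbabilityMeasure P ∧ ∃ U : Ω → ℝ, Measurable U ∧ P.map U = unif01

/-- Membership in `𝒳`: bounded measurable real-valued functions. -/
def BddMeas {Ω : Type*} [MeasurableSpace Ω] (X : Ω → ℝ) : Prop :=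
  Measurable X ∧ ∃ C : ℝ, ∀ ω, |X ω| ≤ C

/-- Two functions are comonotonic. -/
def Comonotone {Ω : Type*} (X Y : Ω → ℝ) : Prop :=
  ∀ ω ω', 0 ≤ (X ω - X ω') * (Y ω - Y ω')

/-- The convex combination `λ P + (1-λ) Q` of two measures. -/
def mixM {Ω : Type*} [MeasurableSpace Ω] (l : ℝ) (P Q : Measure Ω) : Measure Ω :=
  ENNReal.ofReal l • P + ENNReal.ofReal (1 - l) • Q

/-- The Choquet integral `∫ X d(h ∘ P)
  = ∫_{-∞}^0 (h(P(X ≥ x)) − 1) dx + ∫_0^∞ h(P(X ≥ x)) dx`. -/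
def choquet {Ω : Type*} [MeasurableSpace Ω] (h : ℝ → ℝ) (P : Measure Ω) (X : Ω → ℝ) : ℝ :=
  (∫ x in Iic (0:ℝ), (h (P {ω | x ≤ X ω}).toReal - 1)) +
    ∫ x in Ioi (0:ℝ), h (P {ω | x ≤ X ω}).toReal

open ProbabilityTheory Filter Topology

section Atomless

variable {Ω : Type*} [MeasurableSpace Ω]

lemma continuous_cdf (μ : Measure ℝ) [IsProbabilityMeasure μ] [NullSingletonClass μ] :
    Continuous (cdf μ) := by
  refine continuous_iff_continuousAt.2 fun x => ?_
  rw [(monotone_cdf μ).continuousAt_iff_leftLim_eq_rightLim, StieltjesFunction.rightLim_eq]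
  have h : μ {x} = 0 := measure_singleton x
  rw [← measure_cdf μ, StieltjesFunction.measure_singleton, ENNReal.ofReal_eq_zero] at h
  exact le_antisymm ((monotone_cdf μ).leftLim_le le_rfl) (by linarith)

instance : IsProbabilityMeasure unif01 := ⟨by simp [unif01]⟩

instance : NullSingletonClass unif01 := by unfold unif01; infer_instance

lemma unif01_Iic {t : ℝ} (ht : t ∈ Icc (0 : ℝ) 1) : unif01 (Iic t) = ENNReal.ofReal t := by
  have : Iic t ∩ Icc (0 : ℝ) 1 = Icc 0 t := by
    ext x; simp only [mem_inter_iff, mem_Iic, mem_Icc]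
    exact ⟨fun h => ⟨h.2.1, h.1⟩, fun h => ⟨h.2, h.1, h.2.trans ht.2⟩⟩
  rw [unif01, Measure.restrict_apply measurableSet_Iic, this, Real.volume_Icc, sub_zero]

/-- The probability integral transform. -/
lemma map_cdf_eq_unif01 (μ : Measure ℝ) [IsProbabilityMeasure μ] [NullSingletonClass μ] :
    μ.map (cdf μ) = unif01 := by
  have hc := continuous_cdf μ
  have hm : Measurable (cdf μ) := hc.measurable
  have := Measure.isProbabilityMeasure_map (μ := μ) hm.aemeasurable
  have ivt : ∀ t ∈ Ioo (0 : ℝ) 1, ∃ x, cdf μ x = t := fun t ht => by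
    obtain ⟨a, ha⟩ := ((tendsto_cdf_atBot μ).eventually_lt_const ht.1).exists
    obtain ⟨b, hb⟩ := ((tendsto_cdf_atTop μ).eventually_const_lt ht.2).exists
    exact mem_range_of_exists_le_of_exists_ge hc ⟨a, ha.le⟩ ⟨b, hb.le⟩
  have upper : ∀ t : ℝ, ∀ s ∈ Ioo (0 : ℝ) 1, t < s → μ (cdf μ ⁻¹' Iic t) ≤ ENNReal.ofReal s := by
    intro t s hs hts
    obtain ⟨y, rfl⟩ := ivt s hs
    rw [ofReal_cdf]
    refine measure_mono fun x hx => ?_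
    by_contra hxy
    exact absurd (monotone_cdf μ (not_le.1 hxy).le) (not_le.2 ((mem_Iic.1 hx).trans_lt hts))
  refine Measure.ext_of_Iic _ _ fun t => ?_
  rw [Measure.map_apply hm measurableSet_Iic]
  rcases lt_or_ge t 0 with h0 | h0
  · have e : cdf μ ⁻¹' Iic t = ∅ := by
      ext x; simpa using h0.trans_le (cdf_nonneg μ x)
    have e' : Iic t ∩ Icc (0 : ℝ) 1 = ∅ := by
      ext x; simp only [mem_inter_iff, mem_Iic, mem_Icc, mem_empty_iff_false, iff_false]
      intro h; linarith [h.1, h.2.1]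
    rw [e, unif01, Measure.restrict_apply measurableSet_Iic, e']; simp
  rcases le_or_gt 1 t with h1 | h1
  · have e : cdf μ ⁻¹' Iic t = univ := by
      ext x; simpa using (cdf_le_one μ x).trans h1
    have e' : Iic t ∩ Icc (0 : ℝ) 1 = Icc 0 1 := by
      ext x; simp only [mem_inter_iff, mem_Iic, mem_Icc, and_iff_right_iff_imp]
      exact fun h => h.2.trans h1
    rw [e, unif01, Measure.restrict_apply measurableSet_Iic, e']; simp
  rw [unif01_Iic ⟨h0, h1.le⟩]
  apply le_antisymm
  · refine ENNReal.le_ofReal_iff_toReal_le (measure_ne_top _ _) h0 |>.2 ?_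
    refine le_of_forall_gt_imp_ge_of_dense fun s hs => ?_
    rcases lt_or_ge s 1 with hs1 | hs1
    · exact ENNReal.toReal_le_of_le_ofReal (h0.trans hs.le)
        (upper t s ⟨h0.trans_lt hs, hs1⟩ hs)
    · exact measureReal_le_one.trans hs1
  · rcases h0.eq_or_lt with rfl | h0
    · simp
    obtain ⟨x, hx⟩ := ivt t ⟨h0, h1⟩
    rw [← hx, ofReal_cdf]
    exact measure_mono fun y hy => monotone_cdf μ hy

lemma isAtomlessProb_of_noAtoms_map {α : Type*} [MeasurableSpace α] [StandardBorelSpace α]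
    {P : Measure Ω} [IsProbabilityMeasure P] {W : Ω → α}
    (hW : Measurable W) (h : ∀ a, P (W ⁻¹' {a}) = 0) : IsAtomlessProb P := by
  have he := measurableEmbedding_embeddingReal α
  have hm : Measurable (embeddingReal α ∘ W) := he.measurable.comp hW
  have := Measure.isProbabilityMeasure_map (μ := P) hm.aemeasurable
  have : NullSingletonClass (P.map (embeddingReal α ∘ W)) := by
    refine ⟨fun x => ?_⟩
    rw [Measure.map_apply hm (measurableSet_singleton x), preimage_comp]
    by_cases hx : x ∈ range (embeddingReal α)
    · obtain ⟨a, rfl⟩ := hx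
      rw [← image_singleton, he.injective.preimage_image]
      exact h a
    · rw [preimage_singleton_eq_empty.2 hx]; simp
  refine ⟨inferInstance, cdf (P.map (embeddingReal α ∘ W)) ∘ embeddingReal α ∘ W,
    (continuous_cdf _).measurable.comp hm, ?_⟩
  rw [← Measure.map_map (continuous_cdf _).measurable hm, map_cdf_eq_unif01]

lemma IsAtomlessProb.exists_noAtoms {P : Measure Ω} (hP : IsAtomlessProb P) :
    ∃ U : Ω → ℝ, Measurable U ∧ (∀ a, P (U ⁻¹' {a}) = 0) ∧
      ∀ t ∈ Icc (0 : ℝ) 1, P (U ⁻¹' Iic t) = ENNReal.ofReal t := by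
  obtain ⟨_, U, hU, hPU⟩ := hP
  refine ⟨U, hU, fun a => ?_, fun t ht => ?_⟩
  · rw [← Measure.map_apply hU (measurableSet_singleton a), hPU, measure_singleton]
  · rw [← Measure.map_apply hU measurableSet_Iic, hPU, unif01_Iic ht]

lemma IsAtomlessProb.exists_measure_eq {P : Measure Ω} (hP : IsAtomlessProb P) {t : ℝ}
    (ht : t ∈ Icc (0 : ℝ) 1) : ∃ B, MeasurableSet B ∧ P.real B = t := by
  obtain ⟨U, hU, -, hUt⟩ := hP.exists_noAtoms
  exact ⟨U ⁻¹' Iic t, hU measurableSet_Iic, by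
    rw [Measure.real, hUt t ht, ENNReal.toReal_ofReal ht.1]⟩

lemma IsAtomlessProb.exists_ne_zero_compl_ne_zero {P : Measure Ω} (hP : IsAtomlessProb P) :
    ∃ A, MeasurableSet A ∧ P A ≠ 0 ∧ P Aᶜ ≠ 0 := by
  have := hP.1
  obtain ⟨A, hA, hPA⟩ := hP.exists_measure_eq (t := 1 / 2) ⟨by norm_num, by norm_num⟩
  refine ⟨A, hA, fun h => by simp [Measure.real, h] at hPA, fun h => ?_⟩
  have := probReal_compl_eq_one_sub hA (μ := P)
  rw [hPA, Measure.real, h] at this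
  norm_num at this

lemma IsAtomlessProb.cond {P : Measure Ω} (hP : IsAtomlessProb P) {A : Set Ω} (hA : P A ≠ 0) :
    IsAtomlessProb P[|A] := by
  have := hP.1
  obtain ⟨U, hU, hU0, -⟩ := hP.exists_noAtoms
  have := cond_isProbabilityMeasure hA
  exact isAtomlessProb_of_noAtoms_map hU fun a => cond_absolutelyContinuous (hU0 a)

lemma mixM_real_apply {P Q : Measure Ω} [IsProbabilityMeasure P] [IsProbabilityMeasure Q]
    {l : ℝ} (hl : l ∈ Icc (0 : ℝ) 1) (B : Set Ω) :
    (mixM l P Q).real B = l * P.real B + (1 - l) * Q.real B := by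
  simp only [mixM, Measure.real, Measure.add_apply, Measure.smul_apply, smul_eq_mul]
  rw [ENNReal.toReal_add (by finiteness) (by finiteness), ENNReal.toReal_mul, ENNReal.toReal_mul,
    ENNReal.toReal_ofReal hl.1, ENNReal.toReal_ofReal (sub_nonneg.2 hl.2)]

lemma IsAtomlessProb.mixM {P Q : Measure Ω} (hP : IsAtomlessProb P) (hQ : IsAtomlessProb Q)
    {l : ℝ} (hl : l ∈ Icc (0 : ℝ) 1) : IsAtomlessProb (mixM l P Q) := by
  have := hP.1
  have := hQ.1
  obtain ⟨U, hU, hU0, -⟩ := hP.exists_noAtoms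
  obtain ⟨V, hV, hV0, -⟩ := hQ.exists_noAtoms
  have : IsProbabilityMeasure (_root_.mixM l P Q) := ⟨by
    simp only [_root_.mixM, Measure.add_apply, Measure.smul_apply, smul_eq_mul, measure_univ,
      mul_one]
    rw [← ENNReal.ofReal_add hl.1 (sub_nonneg.2 hl.2)]; simp⟩
  refine isAtomlessProb_of_noAtoms_map (hU.prodMk hV) fun a => ?_
  have h1 : P ((fun ω => (U ω, V ω)) ⁻¹' {a}) = 0 :=
    measure_mono_null (fun ω h => by simpa using congrArg Prod.fst h) (hU0 a.1)
  have h2 : Q ((fun ω => (U ω, V ω)) ⁻¹' {a}) = 0 :=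
    measure_mono_null (fun ω h => by simpa using congrArg Prod.snd h) (hV0 a.2)
  simp [_root_.mixM, h1, h2]

lemma mixM_cond {P : Measure Ω} [IsProbabilityMeasure P] {A : Set Ω} (hA : MeasurableSet A) :
    mixM (P.real A) P[|A] P[|Aᶜ] = P := by
  ext B hB
  have h : 1 - P.real A = P.real Aᶜ := by rw [measureReal_compl hA]; simp
  simp only [mixM, h, Measure.add_apply, Measure.smul_apply, smul_eq_mul]
  rw [ofReal_measureReal, ofReal_measureReal, mul_comm (P A), mul_comm (P Aᶜ)]
  exact cond_add_cond_compl_eq hA P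

end Atomless

/-- Monotone, cash-additive and comonotonic additive functionals on bounded measurable
functions. -/
structure IsComonotoneMonetary {Ω : Type*} [MeasurableSpace Ω] (I : (Ω → ℝ) → ℝ) : Prop where
  mono : ∀ X Y, BddMeas X → BddMeas Y → (∀ ω, X ω ≤ Y ω) → I X ≤ I Y
  cash : ∀ X, BddMeas X → ∀ m : ℝ, I (fun ω => X ω + m) = I X + m
  comon : ∀ X Y, BddMeas X → BddMeas Y → Comonotone X Y → I (fun ω => X ω + Y ω) = I X + I Y

section Comonotone

variable {Ω : Type*} {X Y : Ω → ℝ}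

/-- Truncation at level `k` of the integer part of `X`. -/
def floorMin (X : Ω → ℝ) (k : ℕ) (ω : Ω) : ℝ := (min ⌊X ω⌋₊ k : ℕ)

lemma floorMin_zero : floorMin X 0 = fun _ => 0 := by ext; simp [floorMin]

lemma floorMin_succ (k : ℕ) (ω : Ω) : floorMin X (k + 1) ω =
    floorMin X k ω + {ω | ((k + 1 : ℕ) : ℝ) ≤ X ω}.indicator (fun _ => (1 : ℝ)) ω := by
  have h : ω ∈ {ω | ((k + 1 : ℕ) : ℝ) ≤ X ω} ↔ k + 1 ≤ ⌊X ω⌋₊ :=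
    (Nat.le_floor_iff' k.succ_ne_zero (a := X ω)).symm
  by_cases hk : k + 1 ≤ ⌊X ω⌋₊
  · rw [indicator_of_mem (h.2 hk), floorMin, floorMin, min_eq_right hk, min_eq_right (by omega)]
    push_cast; rfl
  · rw [indicator_of_notMem (h.not.2 hk), floorMin, floorMin, min_eq_left (by omega),
      min_eq_left (by omega), add_zero]

lemma floorMin_mono {ω ω' : Ω} (h : X ω ≤ X ω') (k : ℕ) : floorMin X k ω ≤ floorMin X k ω' := by
  rw [floorMin, floorMin, Nat.cast_le]
  exact min_le_min_right _ (Nat.floor_mono h)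

lemma comonotone_of_forall_le
    (h : ∀ ω ω', X ω < X ω' → Y ω ≤ Y ω') : Comonotone X Y := fun ω ω' => by
  rcases lt_trichotomy (X ω) (X ω') with hlt | heq | hlt
  · exact mul_nonneg_of_nonpos_of_nonpos (by linarith) (by linarith [h _ _ hlt])
  · simp [heq]
  · exact mul_nonneg (by linarith) (by linarith [h _ _ hlt])

lemma Comonotone.symm (h : Comonotone X Y) : Comonotone Y X := fun ω ω' => by
  rw [mul_comm]; exact h ω ω'

lemma Comonotone.le_of_lt (h : Comonotone X Y) {ω ω' : Ω} (hlt : X ω < X ω') : Y ω ≤ Y ω' := by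
  by_contra! hc
  exact absurd (h ω ω') (not_le.2 (mul_neg_of_neg_of_pos (by linarith) (by linarith)))

lemma indicator_level_lt {x : ℝ} {ω ω' : Ω}
    (h : {ω | x ≤ X ω}.indicator (fun _ => (1 : ℝ)) ω <
      {ω | x ≤ X ω}.indicator (fun _ => (1 : ℝ)) ω') : X ω < X ω' := by
  by_contra! hle
  refine absurd h (not_lt.2 ?_)
  by_cases h1 : x ≤ X ω'
  · simp [h1, h1.trans hle]
  · rw [indicator_of_notMem (s := {ω | x ≤ X ω}) h1]
    exact indicator_nonneg (fun _ _ => zero_le_one) _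

end Comonotone

section BddMeas

variable {Ω : Type*} [MeasurableSpace Ω] {X Y : Ω → ℝ} {A : Set Ω}

lemma BddMeas.add (hX : BddMeas X) (hY : BddMeas Y) : BddMeas fun ω => X ω + Y ω := by
  obtain ⟨hX, C, hC⟩ := hX
  obtain ⟨hY, D, hD⟩ := hY
  exact ⟨hX.add hY, C + D, fun ω => (abs_add_le _ _).trans (add_le_add (hC ω) (hD ω))⟩

lemma bddMeas_const (c : ℝ) : BddMeas fun _ : Ω => c := ⟨measurable_const, |c|, fun _ => le_rfl⟩

lemma BddMeas.const_mul (hX : BddMeas X) (c : ℝ) : BddMeas fun ω => c * X ω := by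
  obtain ⟨hX, C, hC⟩ := hX
  exact ⟨hX.const_mul c, |c| * C, fun ω => by rw [abs_mul]; gcongr; exact hC ω⟩

lemma bddMeas_indicator (hA : MeasurableSet A) : BddMeas (A.indicator fun _ => (1 : ℝ)) :=
  ⟨measurable_const.indicator hA, 1, fun ω => by
    by_cases h : ω ∈ A <;> simp [h]⟩

lemma BddMeas.measurableSet_le (hX : BddMeas X) (x : ℝ) : MeasurableSet {ω | x ≤ X ω} :=
  _root_.measurableSet_le measurable_const hX.1

lemma bddMeas_floorMin (hX : BddMeas X) (k : ℕ) : BddMeas (floorMin X k) := by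
  refine ⟨measurable_from_top.comp (hX.1.nat_floor.min measurable_const), k, fun ω => ?_⟩
  rw [floorMin, abs_of_nonneg (Nat.cast_nonneg _), Nat.cast_le]
  exact min_le_right _ _

lemma BddMeas.exists_floorMin (hX : BddMeas X) (h0 : ∀ ω, 0 ≤ X ω) :
    ∃ k, ∀ ω, floorMin X k ω ≤ X ω ∧ X ω ≤ floorMin X k ω + 1 := by
  obtain ⟨-, C, hC⟩ := hX
  refine ⟨⌊C⌋₊, fun ω => ?_⟩
  rw [floorMin, min_eq_left (Nat.floor_mono ((le_abs_self _).trans (hC ω)))]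
  exact ⟨Nat.floor_le (h0 ω), (Nat.lt_floor_add_one _).le⟩

end BddMeas

namespace IsComonotoneMonetary

variable {Ω : Type*} [MeasurableSpace Ω] {I J : (Ω → ℝ) → ℝ} {X : Ω → ℝ}

lemma map_zero (hI : IsComonotoneMonetary I) : I (fun _ => 0) = 0 := by
  have := hI.comon (fun _ => 0) (fun _ => 0) (bddMeas_const 0) (bddMeas_const 0)
    (fun _ _ => by simp)
  simp only [add_zero] at this
  linarith

lemma map_nat_mul (hI : IsComonotoneMonetary I) (hX : BddMeas X) (n : ℕ) :
    I (fun ω => n * X ω) = n * I X := by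
  induction n with
  | zero => simpa using hI.map_zero
  | succ n ih =>
    have e : (fun ω => ((n + 1 : ℕ) : ℝ) * X ω) = fun ω => n * X ω + X ω := by
      ext; push_cast; ring
    rw [e, hI.comon _ _ (hX.const_mul n) hX, ih]
    · push_cast; ring
    · intro ω ω'
      rw [← mul_sub, mul_assoc]
      exact mul_nonneg n.cast_nonneg (mul_self_nonneg _)

lemma map_floorMin_eq (hI : IsComonotoneMonetary I) (hJ : IsComonotoneMonetary J)
    (h : ∀ A, MeasurableSet A →
      I (A.indicator fun _ => (1 : ℝ)) = J (A.indicator fun _ => (1 : ℝ)))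
    (hX : BddMeas X) (k : ℕ) : I (floorMin X k) = J (floorMin X k) := by
  induction k with
  | zero => rw [floorMin_zero, hI.map_zero, hJ.map_zero]
  | succ k ih =>
    have hA := hX.measurableSet_le ((k + 1 : ℕ) : ℝ)
    have hc : Comonotone (floorMin X k)
        ({ω | ((k + 1 : ℕ) : ℝ) ≤ X ω}.indicator fun _ => (1 : ℝ)) := 
      (comonotone_of_forall_le fun _ _ hlt => floorMin_mono (indicator_level_lt hlt).le k).symm
    rw [funext (floorMin_succ (X := X) k),
      hI.comon _ _ (bddMeas_floorMin hX k) (bddMeas_indicator hA) hc,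
      hJ.comon _ _ (bddMeas_floorMin hX k) (bddMeas_indicator hA) hc, ih, h _ hA]

/-- Such a functional is determined by its values on indicators. -/
theorem eq_of_indicator (hI : IsComonotoneMonetary I) (hJ : IsComonotoneMonetary J)
    (h : ∀ A, MeasurableSet A →
      I (A.indicator fun _ => (1 : ℝ)) = J (A.indicator fun _ => (1 : ℝ)))
    (hX : BddMeas X) : I X = J X := by
  obtain ⟨C, hC⟩ := hX.2
  set Y : Ω → ℝ := fun ω => X ω + C
  have hY : BddMeas Y := hX.add (bddMeas_const C)
  have hY0 : ∀ ω, 0 ≤ Y ω := fun ω => by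
    have := (abs_le.1 (hC ω)).1
    simp only [Y]; linarith
  have key : ∀ n : ℕ, n * |I Y - J Y| ≤ 1 := fun n => by
    have hnY : BddMeas fun ω => n * Y ω := hY.const_mul n
    obtain ⟨k, hk⟩ := hnY.exists_floorMin fun ω => mul_nonneg n.cast_nonneg (hY0 ω)
    have hF := bddMeas_floorMin hnY k
    have hF1 := hF.add (bddMeas_const 1)
    have e := map_floorMin_eq hI hJ h hnY k
    have i1 := hI.mono _ _ hF hnY fun ω => (hk ω).1
    have i2 := hI.mono _ _ hnY hF1 fun ω => (hk ω).2
    have j1 := hJ.mono _ _ hF hnY fun ω => (hk ω).1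
    have j2 := hJ.mono _ _ hnY hF1 fun ω => (hk ω).2
    rw [hI.cash _ hF] at i2
    rw [hJ.cash _ hF] at j2
    rw [hI.map_nat_mul hY] at i1 i2
    rw [hJ.map_nat_mul hY] at j1 j2
    rw [← abs_of_nonneg (n.cast_nonneg (α := ℝ)), ← abs_mul, abs_le]
    constructor <;> linarith
  have h0 : |I Y - J Y| = 0 := by
    by_contra hne
    have hpos : 0 < |I Y - J Y| := lt_of_le_of_ne (abs_nonneg _) (Ne.symm hne)
    obtain ⟨n, hn⟩ := exists_nat_gt (1 / |I Y - J Y|)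
    rw [div_lt_iff₀ hpos] at hn
    linarith [key n]
  have h1 : I Y = J Y := sub_eq_zero.1 (abs_eq_zero.1 h0)
  simp only [Y] at h1
  rw [hI.cash _ hX, hJ.cash _ hX] at h1
  linarith

end IsComonotoneMonetary

/-- Increasing distortion functions on `[0,1]`. -/
structure IsDistortion (h : ℝ → ℝ) : Prop where
  mono : MonotoneOn h (Icc (0 : ℝ) 1)
  zero : h 0 = 0
  one : h 1 = 1

namespace IsDistortion

variable {Ω : Type*} [MeasurableSpace Ω] {h : ℝ → ℝ} {P : Measure Ω} {X Y : Ω → ℝ}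

lemma choquet_def : choquet h P X = (∫ x in Iic (0 : ℝ), (h (P.real {ω | x ≤ X ω}) - 1)) +
    ∫ x in Ioi (0 : ℝ), h (P.real {ω | x ≤ X ω}) := rfl

lemma apply_eq_zero (hh : IsDistortion h) {x : ℝ} (hx : ∀ ω, X ω < x) :
    h (P.real {ω | x ≤ X ω}) = 0 := by
  rw [eq_empty_of_forall_notMem (s := {ω | x ≤ X ω}) fun ω => not_le.2 (hx ω)]; simp [hh.zero]

lemma choquet_congr_law (hX : Measurable X) (hY : Measurable Y)
    (h_law : P.map X = P.map Y) : choquet h P X = choquet h P Y := by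
  have : ∀ x, P.real {ω | x ≤ X ω} = P.real {ω | x ≤ Y ω} := fun x => by
    have := congrArg (fun μ => μ (Ici x)) h_law
    simp only [Measure.map_apply hX measurableSet_Ici, Measure.map_apply hY measurableSet_Ici]
      at this
    exact congrArg ENNReal.toReal this
  simp only [choquet_def, this]

variable [IsProbabilityMeasure P]

lemma real_mem_Icc (B : Set Ω) : P.real B ∈ Icc (0 : ℝ) 1 :=
  ⟨measureReal_nonneg, measureReal_le_one⟩

lemma antitone (hh : IsDistortion h) (X : Ω → ℝ) :
    Antitone fun x => h (P.real {ω | x ≤ X ω}) := fun _ _ hxy =>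
  hh.mono (real_mem_Icc _) (real_mem_Icc _)
    (measureReal_mono fun _ hω => hxy.trans hω)

lemma intervalIntegrable (hh : IsDistortion h) (X : Ω → ℝ) (a b : ℝ) :
    IntervalIntegrable (fun x => h (P.real {ω | x ≤ X ω})) volume a b :=
  (hh.antitone X).intervalIntegrable

lemma apply_eq_one (hh : IsDistortion h) {x : ℝ} (hx : ∀ ω, x ≤ X ω) :
    h (P.real {ω | x ≤ X ω}) = 1 := by
  rw [eq_univ_of_forall (s := {ω | x ≤ X ω}) hx]; simp [hh.one]

/-- On functions with values in `[a, b]`, the Choquet integral is an integral over `[a, b]`. -/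
lemma choquet_eq (hh : IsDistortion h) {a b : ℝ} (ha : ∀ ω, a ≤ X ω) (hb : ∀ ω, X ω ≤ b) :
    choquet h P X = a + ∫ x in a..b, h (P.real {ω | x ≤ X ω}) := by
  set G := fun x => h (P.real {ω | x ≤ X ω}) with hG
  have hi : ∀ a b, IntervalIntegrable G volume a b := hh.intervalIntegrable X
  have hone : ∀ x, x ≤ a → G x = 1 := fun x hx => hh.apply_eq_one fun ω => hx.trans (ha ω)
  have hzero : ∀ x, b < x → G x = 0 := fun x hx => hh.apply_eq_zero fun ω => (hb ω).trans_lt hx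
  have e1 : ∫ x in Iic (0 : ℝ), (G x - 1) = ∫ x in (min a 0)..0, (G x - 1) := by
    rw [intervalIntegral.integral_of_le (min_le_right _ _)]
    refine setIntegral_eq_of_subset_of_forall_sdiff_eq_zero measurableSet_Iic
      (fun x hx => hx.2) fun x hx => ?_
    rw [hone x, sub_self]
    by_contra! hc
    exact hx.2 ⟨(min_le_left _ _).trans_lt hc, hx.1⟩
  have e2 : ∫ x in Ioi (0 : ℝ), G x = ∫ x in 0..(max b 0), G x := by
    rw [intervalIntegral.integral_of_le (le_max_right _ _)]
    refine setIntegral_eq_of_subset_of_forall_sdiff_eq_zero measurableSet_Ioi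
      (fun x hx => hx.1) fun x hx => ?_
    apply hzero
    by_contra! hc
    exact hx.2 ⟨hx.1, hc.trans (le_max_left _ _)⟩
  have e3 : ∫ x in (min a 0)..a, G x = a - min a 0 := by
    rw [intervalIntegral.integral_congr (g := fun _ => (1 : ℝ))]
    · simp
    · intro x hx
      rw [uIcc_of_le (min_le_left _ _)] at hx
      exact hone x hx.2
  have e4 : ∫ x in b..(max b 0), G x = 0 := by
    rw [intervalIntegral.integral_of_le (le_max_left _ _)]
    exact setIntegral_eq_zero_of_forall_eq_zero fun x hx => hzero x hx.1
  rw [choquet_def, e1, e2, intervalIntegral.integral_sub (hi _ _) (by simp)]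
  have s1 := intervalIntegral.integral_add_adjacent_intervals (hi (min a 0) 0) (hi 0 (max b 0))
  have s2 := intervalIntegral.integral_add_adjacent_intervals (hi (min a 0) a) (hi a b)
  have s3 := intervalIntegral.integral_add_adjacent_intervals (hi (min a 0) b) (hi b (max b 0))
  simp only [intervalIntegral.integral_const, smul_eq_mul]
  linarith

lemma choquet_mono (hh : IsDistortion h) (hX : BddMeas X) (hY : BddMeas Y)
    (hXY : ∀ ω, X ω ≤ Y ω) : choquet h P X ≤ choquet h P Y := by
  obtain ⟨-, C, hC⟩ := hX
  obtain ⟨-, D, hD⟩ := hY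
  obtain ⟨ω₀⟩ := nonempty_of_isProbabilityMeasure P
  have h1 : ∀ ω, -C ≤ X ω := fun ω => (abs_le.1 (hC ω)).1
  have h2 : ∀ ω, Y ω ≤ D := fun ω => (abs_le.1 (hD ω)).2
  rw [hh.choquet_eq h1 fun ω => (hXY ω).trans (h2 ω),
    hh.choquet_eq (fun ω => (h1 ω).trans (hXY ω)) h2]
  gcongr 1
  refine intervalIntegral.integral_mono_on ((h1 ω₀).trans ((hXY ω₀).trans (h2 ω₀)))
    (hh.intervalIntegrable _ _ _) (hh.intervalIntegrable _ _ _) fun x _ => ?_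
  exact hh.mono (real_mem_Icc _) (real_mem_Icc _)
    (measureReal_mono fun ω hω => le_trans hω (hXY ω))

lemma choquet_add_const (hh : IsDistortion h) (hX : BddMeas X) (m : ℝ) :
    choquet h P (fun ω => X ω + m) = choquet h P X + m := by
  obtain ⟨-, C, hC⟩ := hX
  have h1 : ∀ ω, -C ≤ X ω := fun ω => (abs_le.1 (hC ω)).1
  have h2 : ∀ ω, X ω ≤ C := fun ω => (abs_le.1 (hC ω)).2
  rw [hh.choquet_eq h1 h2, hh.choquet_eq (a := -C + m) (b := C + m)
    (fun ω => by linarith [h1 ω]) (fun ω => by linarith [h2 ω]),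
    ← intervalIntegral.integral_comp_add_right]
  simp only [add_le_add_iff_right]
  ring

/-- Additivity with respect to a multiple of a comonotone indicator. -/
lemma choquet_add_indicator (hh : IsDistortion h) (hX : BddMeas X) {A : Set Ω} {c : ℝ}
    (hc : 0 ≤ c) (hA : ∀ ω ∈ A, ∀ ω' ∉ A, X ω' ≤ X ω) :
    choquet h P (fun ω => X ω + c * A.indicator (fun _ => (1 : ℝ)) ω) =
      choquet h P X + c * h (P.real A) := by
  obtain ⟨-, C, hC⟩ := hX
  have h1 : ∀ ω, -C ≤ X ω := fun ω => (abs_le.1 (hC ω)).1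
  have h2 : ∀ ω, X ω ≤ C := fun ω => (abs_le.1 (hC ω)).2
  obtain ⟨ω₀⟩ := nonempty_of_isProbabilityMeasure P
  obtain ⟨m, hm1, hm2⟩ : (upperBounds (insert (-C) (X '' Aᶜ)) ∩
      lowerBounds (insert C (X '' A))).Nonempty := by
    refine exists_between_of_forall_le ⟨_, mem_insert _ _⟩ ⟨_, mem_insert _ _⟩ ?_
    rintro _ (rfl | ⟨ω, hω, rfl⟩) _ (rfl | ⟨ω', hω', rfl⟩)
    · exact (h1 ω₀).trans (h2 ω₀)
    · exact h1 _
    · exact h2 _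
    · exact hA _ hω' _ hω
  have hCm : -C ≤ m := hm1 (mem_insert _ _)
  have hmC : m ≤ C := hm2 (mem_insert _ _)
  have hin : ∀ ω ∈ A, m ≤ X ω := fun ω hω => hm2 (mem_insert_of_mem _ ⟨ω, hω, rfl⟩)
  have hout : ∀ ω ∉ A, X ω ≤ m := fun ω hω => hm1 (mem_insert_of_mem _ ⟨ω, hω, rfl⟩)
  set Z := fun ω => X ω + c * A.indicator (fun _ => (1 : ℝ)) ω with hZ
  have hZin : ∀ ω ∈ A, Z ω = X ω + c := fun ω hω => by simp [hZ, hω]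
  have hZout : ∀ ω ∉ A, Z ω = X ω := fun ω hω => by simp [hZ, hω]
  have e1 : ∫ x in (-C)..m, h (P.real {ω | x ≤ Z ω}) = ∫ x in (-C)..m, h (P.real {ω | x ≤ X ω}) := by
    refine intervalIntegral.integral_congr fun x hx => ?_
    rw [uIcc_of_le hCm] at hx
    have : {ω | x ≤ Z ω} = {ω | x ≤ X ω} := by
      ext ω
      by_cases hω : ω ∈ A
      · have := hin ω hω
        simp only [mem_ofPred_eq, hZin ω hω]
        exact iff_of_true (by linarith [hx.2]) (by linarith [hx.2])
      · simp only [mem_ofPred_eq, hZout ω hω]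
    simp only [this]
  have e2 : ∫ x in m..(m + c), h (P.real {ω | x ≤ Z ω}) = c * h (P.real A) := by
    have : ∫ x in m..(m + c), h (P.real {ω | x ≤ Z ω}) = ∫ _ in m..(m + c), h (P.real A) := by
      refine intervalIntegral.integral_congr_ae (ae_of_all _ fun x hx => ?_)
      rw [uIoc_of_le (by linarith)] at hx
      have : {ω | x ≤ Z ω} = A := by
        ext ω
        by_cases hω : ω ∈ A
        · have := hin ω hω
          simp only [mem_ofPred_eq, hZin ω hω]
          exact iff_of_true (by linarith [hx.2]) hω
        · have := hout ω hω
          simp only [mem_ofPred_eq, hZout ω hω]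
          exact iff_of_false (by linarith [hx.1]) hω
      rw [this]
    rw [this]; simp
  have e3 : ∫ x in (m + c)..(C + c), h (P.real {ω | x ≤ Z ω}) =
      ∫ x in m..C, h (P.real {ω | x ≤ X ω}) := by
    rw [← intervalIntegral.integral_comp_add_right]
    refine intervalIntegral.integral_congr_ae (ae_of_all _ fun x hx => ?_)
    rw [uIoc_of_le hmC] at hx
    have : {ω | x + c ≤ Z ω} = {ω | x ≤ X ω} := by
      ext ω
      by_cases hω : ω ∈ A
      · simp only [mem_ofPred_eq, hZin ω hω, add_le_add_iff_right]
      · have := hout ω hω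
        simp only [mem_ofPred_eq, hZout ω hω]
        exact iff_of_false (by linarith [hx.1]) (by linarith [hx.1])
    rw [this]
  have hZ1 : ∀ ω, -C ≤ Z ω := fun ω => by
    by_cases hω : ω ∈ A
    · linarith [hZin ω hω, h1 ω]
    · linarith [hZout ω hω, h1 ω]
  have hZ2 : ∀ ω, Z ω ≤ C + c := fun ω => by
    by_cases hω : ω ∈ A
    · linarith [hZin ω hω, h2 ω]
    · linarith [hZout ω hω, h2 ω]
  have hiX := hh.intervalIntegrable (P := P) X
  have hiZ := hh.intervalIntegrable (P := P) Z
  rw [hh.choquet_eq hZ1 hZ2, hh.choquet_eq h1 h2,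
    ← intervalIntegral.integral_add_adjacent_intervals (hiX (-C) m) (hiX m C),
    ← intervalIntegral.integral_add_adjacent_intervals (hiZ (-C) m) (hiZ m (C + c)),
    ← intervalIntegral.integral_add_adjacent_intervals (hiZ m (m + c)) (hiZ (m + c) (C + c)),
    e1, e2, e3]
  ring

lemma choquet_zero (hh : IsDistortion h) : choquet h P (fun _ => 0) = 0 := by
  rw [hh.choquet_eq (a := 0) (b := 0) (fun _ => le_rfl) (fun _ => le_rfl)]; simp

lemma choquet_indicator (hh : IsDistortion h) (A : Set Ω) :
    choquet h P (A.indicator fun _ => (1 : ℝ)) = h (P.real A) := by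
  simpa [hh.choquet_zero] using hh.choquet_add_indicator (P := P) (bddMeas_const 0) (A := A)
    zero_le_one fun _ _ _ _ => le_rfl

/-- Additivity with respect to step functions of a comonotone function. -/
lemma choquet_add_floorMin (hh : IsDistortion h) (hX : BddMeas X) (hY : BddMeas Y)
    (hXY : ∀ ω ω', Y ω < Y ω' → X ω ≤ X ω') {c : ℝ} (hc : 0 ≤ c) (k : ℕ) :
    choquet h P (fun ω => X ω + c * floorMin Y k ω) =
      choquet h P X + choquet h P (fun ω => c * floorMin Y k ω) := by
  have step : ∀ {Z : Ω → ℝ} (k : ℕ), BddMeas Z → (∀ ω ω', Y ω < Y ω' → Z ω ≤ Z ω') →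
      choquet h P (fun ω => Z ω + c * floorMin Y (k + 1) ω) =
        choquet h P (fun ω => Z ω + c * floorMin Y k ω) +
          c * h (P.real {ω | ((k + 1 : ℕ) : ℝ) ≤ Y ω}) := by
    intro Z k hZ hZY
    have e : (fun ω => Z ω + c * floorMin Y (k + 1) ω) = fun ω => (Z ω + c * floorMin Y k ω) +
        c * {ω | ((k + 1 : ℕ) : ℝ) ≤ Y ω}.indicator (fun _ => (1 : ℝ)) ω := by
      ext ω; rw [floorMin_succ]; ring
    rw [e, hh.choquet_add_indicator (hZ.add ((bddMeas_floorMin hY k).const_mul c)) hc]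
    intro ω hω ω' hω'
    have hlt : Y ω' < Y ω := (not_le.1 hω').trans_le hω
    have := hZY _ _ hlt
    have := floorMin_mono hlt.le k
    gcongr
  induction k with
  | zero => simp [floorMin_zero, hh.choquet_zero]
  | succ k ih =>
    have h0 := step (Z := fun _ => 0) k (bddMeas_const 0) fun _ _ _ => le_rfl
    simp only [zero_add] at h0
    rw [step k hX hXY, ih, h0]
    ring

lemma choquet_add_of_nonneg (hh : IsDistortion h) (hX : BddMeas X) (hY : BddMeas Y)
    (hY0 : ∀ ω, 0 ≤ Y ω) (hXY : ∀ ω ω', Y ω < Y ω' → X ω ≤ X ω') :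
    choquet h P (fun ω => X ω + Y ω) = choquet h P X + choquet h P Y := by
  have key : ∀ c : ℝ, 0 < c →
      |choquet h P (fun ω => X ω + Y ω) - (choquet h P X + choquet h P Y)| ≤ c := by
    intro c hc
    have hY' : BddMeas fun ω => c⁻¹ * Y ω := hY.const_mul _
    obtain ⟨k, hk⟩ := hY'.exists_floorMin fun ω => mul_nonneg (by positivity) (hY0 ω)
    set F : Ω → ℝ := fun ω => c * floorMin (fun ω => c⁻¹ * Y ω) k ω with hFdef
    have hF : BddMeas F := (bddMeas_floorMin hY' k).const_mul c
    have hF1 : ∀ ω, F ω ≤ Y ω := fun ω => by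
      have := mul_le_mul_of_nonneg_left (hk ω).1 hc.le
      rwa [mul_inv_cancel_left₀ hc.ne'] at this
    have hF2 : ∀ ω, Y ω ≤ F ω + c := fun ω => by
      have := mul_le_mul_of_nonneg_left (hk ω).2 hc.le
      rwa [mul_inv_cancel_left₀ hc.ne', mul_add, mul_one] at this
    have e : choquet h P (fun ω => X ω + F ω) = choquet h P X + choquet h P F :=
      hh.choquet_add_floorMin hX hY'
        (fun ω ω' hlt => hXY _ _ (lt_of_mul_lt_mul_left hlt (by positivity))) hc.le k
    have a1 := hh.choquet_mono (P := P) hF hY hF1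
    have a2 := hh.choquet_mono (P := P) hY (hF.add (bddMeas_const c)) hF2
    have b1 := hh.choquet_mono (P := P) (hX.add hF) (hX.add hY)
      fun ω => by linarith [hF1 ω]
    have b2 := hh.choquet_mono (P := P) (hX.add hY) ((hX.add hF).add (bddMeas_const c))
      fun ω => by linarith [hF2 ω]
    rw [hh.choquet_add_const hF] at a2
    rw [hh.choquet_add_const (hX.add hF)] at b2
    rw [abs_le]
    constructor <;> linarith
  exact sub_eq_zero.1 (abs_nonpos_iff.1 (le_of_forall_gt_imp_ge_of_dense key))

theorem isComonotoneMonetary_choquet (hh : IsDistortion h) :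
    IsComonotoneMonetary (choquet h P) where
  mono _ _ := hh.choquet_mono
  cash _ := hh.choquet_add_const
  comon X Y hX hY hXY := by
    obtain ⟨C, hC⟩ := hY.2
    have hYC : BddMeas fun ω => Y ω + C := hY.add (bddMeas_const C)
    have := hh.choquet_add_of_nonneg (P := P) hX hYC
      (fun ω => by linarith [(abs_le.1 (hC ω)).1])
      fun ω ω' hlt => hXY.symm.le_of_lt (by simpa using hlt)
    simp only [← add_assoc] at this
    rw [hh.choquet_add_const (hX.add hY), hh.choquet_add_const hY] at this
    linarith

lemma choquet_mixM (hh : IsDistortion h) (hconc : ConcaveOn ℝ (Icc (0 : ℝ) 1) h)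
    {Q : Measure Ω} (hP : IsAtomlessProb P) (hQ : IsAtomlessProb Q) {l : ℝ}
    (hl : l ∈ Icc (0 : ℝ) 1) (hX : BddMeas X) :
    l * choquet h P X + (1 - l) * choquet h Q X ≤ choquet h (mixM l P Q) X := by
  have := hQ.1
  have := (hP.mixM hQ hl).1
  obtain ⟨-, C, hC⟩ := hX
  have h1 : ∀ ω, -C ≤ X ω := fun ω => (abs_le.1 (hC ω)).1
  have h2 : ∀ ω, X ω ≤ C := fun ω => (abs_le.1 (hC ω)).2
  obtain ⟨ω₀⟩ := nonempty_of_isProbabilityMeasure P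
  have hmono := intervalIntegral.integral_mono_on ((h1 ω₀).trans (h2 ω₀))
    (((hh.intervalIntegrable (P := P) X (-C) C).const_mul l).add
      ((hh.intervalIntegrable (P := Q) X (-C) C).const_mul (1 - l)))
    (hh.intervalIntegrable (P := mixM l P Q) X (-C) C) fun x _ => by
      rw [mixM_real_apply hl]
      exact hconc.2 (real_mem_Icc _) (real_mem_Icc _) hl.1 (sub_nonneg.2 hl.2) (by ring)
  rw [intervalIntegral.integral_add ((hh.intervalIntegrable X _ _).const_mul l)
    ((hh.intervalIntegrable X _ _).const_mul _), intervalIntegral.integral_const_mul,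
    intervalIntegral.integral_const_mul] at hmono
  rw [hh.choquet_eq h1 h2, hh.choquet_eq h1 h2, hh.choquet_eq h1 h2]
  linarith

end IsDistortion

section RealFunctions

variable {f k : ℝ → ℝ}

lemma increment_le (hfk : ∀ p ∈ Icc (0 : ℝ) 1, ∀ q ∈ Icc (0 : ℝ) 1,
      f p + k q ≤ f ((p + q) / 2) + k ((p + q) / 2))
    {m d : ℝ} (hd : 0 ≤ d) (h0 : 0 ≤ m - d) (h1 : m + d ≤ 1) :
    f (m + d) - f m ≤ k m - k (m - d) := by
  have := hfk (m + d) ⟨by linarith, h1⟩ (m - d) ⟨h0, by linarith⟩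
  rw [show (m + d + (m - d)) / 2 = m by ring] at this
  linarith

lemma decrement_le (hfk : ∀ p ∈ Icc (0 : ℝ) 1, ∀ q ∈ Icc (0 : ℝ) 1,
      f p + k q ≤ f ((p + q) / 2) + k ((p + q) / 2))
    {m d : ℝ} (hd : 0 ≤ d) (h0 : 0 ≤ m - d) (h1 : m + d ≤ 1) :
    k (m + d) - k m ≤ f m - f (m - d) := by
  have := hfk (m - d) ⟨h0, by linarith⟩ (m + d) ⟨by linarith, h1⟩
  rw [show (m - d + (m + d)) / 2 = m by ring] at this
  linarith

lemma nat_mul_increment_le (hf : MonotoneOn f (Icc (0 : ℝ) 1))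
    (hfk : ∀ p ∈ Icc (0 : ℝ) 1, ∀ q ∈ Icc (0 : ℝ) 1,
      f p + k q ≤ f ((p + q) / 2) + k ((p + q) / 2))
    {d : ℝ} (hd : 0 ≤ d) (n : ℕ) {t : ℝ} (ht : t ≤ 1) (hnt : (2 * n + 1) * d ≤ t) :
    n * (f t - f (t - d)) ≤ f t - f (t - 2 * n * d) := by
  induction n generalizing t with
  | zero => simp
  | succ n ih =>
    push_cast at hnt ⊢
    have hnd : 0 ≤ n * d := by positivity
    have i1 := increment_le hfk (m := t - d) hd (by linarith) (by linarith)
    have i2 := decrement_le hfk (m := t - d - d) hd (by linarith) (by linarith)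
    rw [sub_add_cancel] at i1 i2
    have i3 := ih (t := t - d - d) (by linarith) (by linarith)
    have i4 := mul_le_mul_of_nonneg_left (i1.trans i2) n.cast_nonneg
    have i5 := hf (a := t - d - d) (b := t - d) ⟨by linarith, by linarith⟩
      ⟨by linarith, by linarith⟩ (by linarith)
    rw [show t - d - d - 2 * n * d = t - 2 * (n + 1) * d by ring] at i3
    linarith

lemma add_nat_mul_increment_le (hfk : ∀ p ∈ Icc (0 : ℝ) 1, ∀ q ∈ Icc (0 : ℝ) 1,
      f p + k q ≤ f ((p + q) / 2) + k ((p + q) / 2))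
    {d : ℝ} (hd : 0 ≤ d) (n : ℕ) {t : ℝ} (hdt : d ≤ t) (ht : t + n * d ≤ 1) :
    k (t + n * d) - k t ≤ f (t + n * d - d) - f (t - d) := by
  induction n with
  | zero => simp
  | succ n ih =>
    push_cast at ht ⊢
    have hnd : 0 ≤ n * d := by positivity
    have i := decrement_le hfk (m := t + n * d) hd (by linarith) (by linarith)
    have := ih (by linarith)
    rw [show t + (n + 1) * d = t + n * d + d by ring, add_sub_cancel_right]
    linarith

lemma IsDistortion.nonneg {h : ℝ → ℝ} (hh : IsDistortion h) {t : ℝ} (ht : t ∈ Icc (0 : ℝ) 1) :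
    0 ≤ h t := hh.zero ▸ hh.mono (by simp) ht ht.1

lemma IsDistortion.le_one {h : ℝ → ℝ} (hh : IsDistortion h) {t : ℝ} (ht : t ∈ Icc (0 : ℝ) 1) :
    h t ≤ 1 := hh.one ▸ hh.mono ht (by simp) ht.2

lemma IsDistortion.le_of_midpoint (hf : IsDistortion f) (hk : IsDistortion k)
    (hfk : ∀ p ∈ Icc (0 : ℝ) 1, ∀ q ∈ Icc (0 : ℝ) 1,
      f p + k q ≤ f ((p + q) / 2) + k ((p + q) / 2)) {t : ℝ} (ht : t ∈ Icc (0 : ℝ) 1) :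
    f t ≤ k t := by
  rcases ht.1.eq_or_lt with rfl | h0
  · rw [hf.zero, hk.zero]
  have key : ∀ n : ℕ, n * (f t - k t) ≤ 1 := fun n => by
    obtain ⟨N, hN⟩ := exists_nat_gt ((2 * n + 1) * (1 - t) / t)
    have hNpos : (0 : ℝ) < N := lt_of_le_of_lt
      (div_nonneg (mul_nonneg (by positivity) (sub_nonneg.2 ht.2)) h0.le) hN
    set d := (1 - t) / N with hd
    have hd0 : 0 ≤ d := div_nonneg (sub_nonneg.2 ht.2) hNpos.le
    have hNd : N * d = 1 - t := mul_div_cancel₀ _ hNpos.ne'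
    have hnd : (2 * n + 1) * d ≤ t := by
      rw [hd, ← mul_div_assoc, div_le_iff₀ hNpos]
      rw [div_lt_iff₀ h0] at hN
      linarith
    have hn0 : 0 ≤ n * d := by positivity
    have i1 := nat_mul_increment_le hf.mono hfk hd0 n ht.2 hnd
    have i2 := add_nat_mul_increment_le hfk hd0 N (by linarith) (by linarith : t + N * d ≤ 1)
    rw [hNd, add_sub_cancel, hk.one] at i2
    have i3 := hf.le_one (t := 1 - d) ⟨by linarith [ht.2], by linarith⟩
    have i4 := hf.le_one ht
    have i5 := hf.nonneg (t := t - 2 * n * d) ⟨by linarith, by linarith [ht.2]⟩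
    have i6 := mul_le_mul_of_nonneg_left (show f t - k t ≤ f t - f (t - d) by linarith)
      (n.cast_nonneg (α := ℝ))
    linarith
  by_contra! hlt
  obtain ⟨n, hn⟩ := exists_nat_gt (1 / (f t - k t))
  rw [div_lt_iff₀ (sub_pos.2 hlt)] at hn
  linarith [key n]

end RealFunctions

/-- Law invariant, ambiguity sensitive cores that are monotone, cash-additive and
comonotonic additive. -/
structure IsSensitiveCore {Ω : Type*} [MeasurableSpace Ω] (Ψ : (Ω → ℝ) → Measure Ω → ℝ) :
    Prop where
  law : ∀ X Y : Ω → ℝ, BddMeas X → BddMeas Y → ∀ P : Measure Ω, IsAtomlessProb P →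
    P.map X = P.map Y → Ψ X P = Ψ Y P
  sensitive : ∀ X : Ω → ℝ, BddMeas X → ∀ P Q : Measure Ω, IsAtomlessProb P → IsAtomlessProb Q →
    ∀ l : ℝ, l ∈ Icc (0:ℝ) 1 → l * Ψ X P + (1 - l) * Ψ X Q ≤ Ψ X (mixM l P Q)
  indicator : ∀ A : Set Ω, MeasurableSet A → ∀ P Q : Measure Ω, IsAtomlessProb P →
    IsAtomlessProb Q → P A = Q A → ∀ l : ℝ, l ∈ Icc (0:ℝ) 1 →
    Ψ (A.indicator fun _ => (1:ℝ)) (mixM l P Q) =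
      l * Ψ (A.indicator fun _ => (1:ℝ)) P + (1 - l) * Ψ (A.indicator fun _ => (1:ℝ)) Q
  monetary : ∀ P : Measure Ω, IsAtomlessProb P → IsComonotoneMonetary fun X => Ψ X P

namespace IsSensitiveCore

variable {Ω : Type*} [MeasurableSpace Ω] {Ψ : (Ω → ℝ) → Measure Ω → ℝ} {P Q : Measure Ω}

lemma map_indicator_congr [IsProbabilityMeasure P] {A B : Set Ω} (hA : MeasurableSet A)
    (hB : MeasurableSet B) (hAB : P.real A = P.real B) :
    P.map (A.indicator fun _ => (1 : ℝ)) = P.map (B.indicator fun _ => (1 : ℝ)) := by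
  have h1 : P A = P B := (measureReal_eq_measureReal_iff).1 hAB
  have h2 : P Aᶜ = P Bᶜ := by
    rw [prob_compl_eq_one_sub hA, prob_compl_eq_one_sub hB, h1]
  ext s hs
  rw [Measure.map_apply (bddMeas_indicator hA).1 hs, Measure.map_apply (bddMeas_indicator hB).1 hs]
  classical
  rw [indicator_const_preimage_eq_union, indicator_const_preimage_eq_union]
  split_ifs <;> simp [h1, h2]

/-- The function `h` describes the values of `Ψ · P` on indicators. -/
def Represents (Ψ : (Ω → ℝ) → Measure Ω → ℝ) (P : Measure Ω) (h : ℝ → ℝ) : Prop :=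
  ∀ B, MeasurableSet B → Ψ (B.indicator fun _ => (1 : ℝ)) P = h (P.real B)

lemma exists_represents (hΨ : IsSensitiveCore Ψ) (hP : IsAtomlessProb P) :
    ∃ h, IsDistortion h ∧ Represents Ψ P h := by
  have := hP.1
  have hI := hΨ.monetary P hP
  obtain ⟨U, hU, -, hUt⟩ := hP.exists_noAtoms
  have hmeas : ∀ t, MeasurableSet (U ⁻¹' Iic t) := fun t => hU measurableSet_Iic
  have hrep : Represents Ψ P fun t => Ψ ((U ⁻¹' Iic t).indicator fun _ => (1 : ℝ)) P := by
    intro B hB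
    refine hΨ.law _ _ (bddMeas_indicator hB) (bddMeas_indicator (hmeas _)) P hP
      (map_indicator_congr hB (hmeas _) ?_)
    rw [measureReal_def (s := U ⁻¹' _), hUt _ (IsDistortion.real_mem_Icc B),
      ENNReal.toReal_ofReal measureReal_nonneg]
  refine ⟨_, ⟨fun s _ t _ hst => ?_, ?_, ?_⟩, hrep⟩
  · refine hI.mono _ _ (bddMeas_indicator (hmeas s)) (bddMeas_indicator (hmeas t)) fun ω => ?_
    exact indicator_le_indicator_of_subset (preimage_mono (Iic_subset_Iic.2 hst))
      (fun _ => zero_le_one) ω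
  · have := hrep ∅ MeasurableSet.empty
    rw [indicator_empty, measureReal_empty] at this
    exact this.symm.trans hI.map_zero
  · have := hrep univ MeasurableSet.univ
    rw [indicator_univ, probReal_univ] at this
    have h1 := hI.cash (fun _ => 0) (bddMeas_const 0) 1
    rw [hI.map_zero] at h1
    simp only [zero_add] at h1
    exact this.symm.trans h1

lemma represents_congr {f k : ℝ → ℝ} (hP : IsAtomlessProb P) (hf : Represents Ψ P f)
    (hk : Represents Ψ P k) {t : ℝ} (ht : t ∈ Icc (0 : ℝ) 1) : f t = k t := by
  obtain ⟨B, hB, rfl⟩ := hP.exists_measure_eq ht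
  rw [← hf B hB, hk B hB]

/-- Two probability measures that are carried by disjoint measurable sets. -/
def Separated (P Q : Measure Ω) : Prop := ∃ S, MeasurableSet S ∧ P Sᶜ = 0 ∧ Q S = 0

lemma Separated.exists_measure_eq (hPQ : Separated P Q) (hP : IsAtomlessProb P)
    (hQ : IsAtomlessProb Q) {p q : ℝ} (hp : p ∈ Icc (0 : ℝ) 1) (hq : q ∈ Icc (0 : ℝ) 1) :
    ∃ B, MeasurableSet B ∧ P.real B = p ∧ Q.real B = q := by
  obtain ⟨S, hS, hPS, hQS⟩ := hPQ
  obtain ⟨B, hB, rfl⟩ := hP.exists_measure_eq hp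
  obtain ⟨D, hD, rfl⟩ := hQ.exists_measure_eq hq
  refine ⟨S.ite B D, hS.ite hB hD, measureReal_congr (eventuallyEq_set.2 ?_),
    measureReal_congr (eventuallyEq_set.2 ?_)⟩
  · have : ∀ᵐ ω ∂P, ω ∈ S := by rw [ae_iff]; exact hPS
    filter_upwards [this] with ω hω
    simp [Set.ite, hω]
  · have : ∀ᵐ ω ∂Q, ω ∉ S := by rw [ae_iff]; simpa using hQS
    filter_upwards [this] with ω hω
    simp [Set.ite, hω]

lemma mix_le (hΨ : IsSensitiveCore Ψ) (hPQ : Separated P Q) (hP : IsAtomlessProb P)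
    (hQ : IsAtomlessProb Q) {f k : ℝ → ℝ} (hf : Represents Ψ P f) (hk : Represents Ψ Q k)
    {l p q : ℝ} (hl : l ∈ Icc (0 : ℝ) 1) (hp : p ∈ Icc (0 : ℝ) 1) (hq : q ∈ Icc (0 : ℝ) 1) :
    l * f p + (1 - l) * k q ≤
      l * f (l * p + (1 - l) * q) + (1 - l) * k (l * p + (1 - l) * q) := by
  have := hP.1
  have := hQ.1
  set r := l * p + (1 - l) * q
  have hr : r ∈ Icc (0 : ℝ) 1 :=
    convex_Icc (0 : ℝ) 1 hp hq hl.1 (sub_nonneg.2 hl.2) (by ring)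
  obtain ⟨h, -, hh⟩ := hΨ.exists_represents (hP.mixM hQ hl)
  obtain ⟨B, hB, rfl, rfl⟩ := hPQ.exists_measure_eq hP hQ hp hq
  obtain ⟨D, hD, hDP, hDQ⟩ := hPQ.exists_measure_eq hP hQ hr hr
  have e1 := hΨ.sensitive _ (bddMeas_indicator hB) P Q hP hQ l hl
  have e2 := hΨ.indicator D hD P Q hP hQ
    ((measureReal_eq_measureReal_iff).1 (hDP.trans hDQ.symm)) l hl
  rw [hf B hB, hk B hB, hh B hB, mixM_real_apply hl] at e1
  rw [hf D hD, hk D hD, hh D hD, mixM_real_apply hl, hDP, hDQ, ← add_mul, add_sub_cancel,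
    one_mul] at e2
  exact e1.trans e2.le

lemma eq_of_separated (hΨ : IsSensitiveCore Ψ) (hPQ : Separated P Q) (hP : IsAtomlessProb P)
    (hQ : IsAtomlessProb Q) {f k : ℝ → ℝ} (hf : Represents Ψ P f) (hk : Represents Ψ Q k)
    (hfd : IsDistortion f) (hkd : IsDistortion k) {t : ℝ} (ht : t ∈ Icc (0 : ℝ) 1) :
    f t = k t := by
  have key : ∀ p ∈ Icc (0 : ℝ) 1, ∀ q ∈ Icc (0 : ℝ) 1,
      f p + k q ≤ f ((p + q) / 2) + k ((p + q) / 2) := fun p hp q hq => by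
    have := hΨ.mix_le hPQ hP hQ hf hk (l := 1 / 2) ⟨by norm_num, by norm_num⟩ hp hq
    rw [show 1 / 2 * p + (1 - 1 / 2) * q = (p + q) / 2 by ring] at this
    linarith
  refine le_antisymm (hfd.le_of_midpoint hkd key ht) (hkd.le_of_midpoint hfd ?_ ht)
  intro p hp q hq
  have := key q hq p hp
  rw [add_comm q p] at this
  linarith

lemma cond_separated {A : Set Ω} (hA : MeasurableSet A) :
    Separated P[|A] Q[|Aᶜ] :=
  ⟨A, hA, by rw [cond_apply hA]; simp, by rw [cond_apply hA.compl]; simp⟩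

lemma represents_cond (hΨ : IsSensitiveCore Ψ) (hP : IsAtomlessProb P) {A : Set Ω}
    (hA : MeasurableSet A) (hPA : P A ≠ 0) {f k : ℝ → ℝ} (hf : Represents Ψ P f)
    (hk : Represents Ψ P[|A] k) (hkd : IsDistortion k) {t : ℝ} (ht : t ∈ Icc (0 : ℝ) 1) :
    f t = k t := by
  have := hP.1
  have hPk := hP.cond hPA
  by_cases hc : P Aᶜ = 0
  · have : P[|A] = P := by
      ext B hB
      rw [cond_apply hA, (prob_compl_eq_zero_iff hA).1 hc, inv_one, one_mul]
      rw [inter_comm]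
      exact measure_inter_conull hc
    rw [this] at hk
    exact represents_congr hP hf hk ht
  have hPc := hP.cond hc
  obtain ⟨g, hgd, hg⟩ := hΨ.exists_represents hPc
  have hsep := cond_separated (P := P) (Q := P) hA
  obtain ⟨B, hB, hB1, hB2⟩ := hsep.exists_measure_eq hPk hPc ht ht
  have hgk := hΨ.eq_of_separated hsep hPk hPc hk hg hkd hgd ht
  have := hPk.1
  have := hPc.1
  have hl : P.real A ∈ Icc (0 : ℝ) 1 := IsDistortion.real_mem_Icc A
  have e := hΨ.indicator B hB _ _ hPk hPc
    ((measureReal_eq_measureReal_iff).1 (hB1.trans hB2.symm)) _ hl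
  have hPB := mixM_real_apply (P := P[|A]) (Q := P[|Aᶜ]) hl B
  rw [mixM_cond hA, hk B hB, hg B hB, hf B hB, hB1, hB2, ← hgk, ← add_mul, add_sub_cancel,
    one_mul] at e
  rw [mixM_cond hA, hB1, hB2, ← add_mul, add_sub_cancel, one_mul] at hPB
  rwa [hPB] at e

lemma represents_unique (hΨ : IsSensitiveCore Ψ) (hP : IsAtomlessProb P) (hQ : IsAtomlessProb Q)
    {f k : ℝ → ℝ} (hf : Represents Ψ P f) (hk : Represents Ψ Q k) {t : ℝ}
    (ht : t ∈ Icc (0 : ℝ) 1) : f t = k t := by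
  have := hP.1
  have := hQ.1
  have key : ∀ A, MeasurableSet A → P A ≠ 0 → Q Aᶜ ≠ 0 → f t = k t := by
    intro A hA hPA hQA
    obtain ⟨f', hfd, hf'⟩ := hΨ.exists_represents (hP.cond hPA)
    obtain ⟨k', hkd, hk'⟩ := hΨ.exists_represents (hQ.cond hQA)
    rw [hΨ.represents_cond hP hA hPA hf hf' hfd ht,
      hΨ.represents_cond hQ hA.compl hQA hk hk' hkd ht]
    exact hΨ.eq_of_separated (cond_separated hA) (hP.cond hPA) (hQ.cond hQA) hf' hk' hfd hkd ht
  obtain ⟨A, hA, h1, h2⟩ := hP.exists_ne_zero_compl_ne_zero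
  by_cases hQA : Q Aᶜ = 0
  · refine key Aᶜ hA.compl h2 ?_
    rw [compl_compl, (prob_compl_eq_zero_iff hA).1 hQA]
    exact one_ne_zero
  · exact key A hA h1 hQA

lemma eq_choquet (hΨ : IsSensitiveCore Ψ) (hP : IsAtomlessProb P) {h : ℝ → ℝ}
    (hh : IsDistortion h) (hr : Represents Ψ P h) {X : Ω → ℝ} (hX : BddMeas X) :
    Ψ X P = choquet h P X := by
  have := hP.1
  refine (hΨ.monetary P hP).eq_of_indicator hh.isComonotoneMonetary_choquet (fun A hA => ?_) hX
  rw [hh.choquet_indicator]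
  exact hr A hA

lemma concaveOn (hΨ : IsSensitiveCore Ψ) (hP : IsAtomlessProb P) {h : ℝ → ℝ}
    (hr : Represents Ψ P h) : ConcaveOn ℝ (Icc (0 : ℝ) 1) h := by
  have := hP.1
  refine ⟨convex_Icc _ _, fun p hp q hq a b ha hb hab => ?_⟩
  obtain rfl : b = 1 - a := by linarith
  have hl : a ∈ Icc (0 : ℝ) 1 := ⟨ha, by linarith⟩
  obtain ⟨A, hA, h1, h2⟩ := hP.exists_ne_zero_compl_ne_zero
  obtain ⟨f, -, hf⟩ := hΨ.exists_represents (hP.cond h1)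
  obtain ⟨k, -, hk⟩ := hΨ.exists_represents (hP.cond h2)
  have hle := hΨ.mix_le (cond_separated hA) (hP.cond h1) (hP.cond h2) hf hk hl hp hq
  have hm : a * p + (1 - a) * q ∈ Icc (0 : ℝ) 1 := convex_Icc (0 : ℝ) 1 hp hq ha hb hab
  have ef := fun {t : ℝ} (ht : t ∈ Icc (0 : ℝ) 1) =>
    hΨ.represents_unique (hP.cond h1) hP hf hr ht
  have ek := fun {t : ℝ} (ht : t ∈ Icc (0 : ℝ) 1) =>
    hΨ.represents_unique (hP.cond h2) hP hk hr ht
  rw [ef hp, ek hq, ef hm, ek hm, ← add_mul, add_sub_cancel, one_mul] at hle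
  exact hle

lemma represents_of_represents (hΨ : IsSensitiveCore Ψ) (hP : IsAtomlessProb P)
    (hQ : IsAtomlessProb Q) {h : ℝ → ℝ} (hr : Represents Ψ P h) : Represents Ψ Q h := by
  have := hQ.1
  obtain ⟨k, -, hk⟩ := hΨ.exists_represents hQ
  intro B hB
  rw [hk B hB, hΨ.represents_unique hP hQ hr hk (IsDistortion.real_mem_Icc B)]

end IsSensitiveCore

/-- Theorem (loss law-invariant, ambiguity-sensitive, monetary, comonotonic-additive
cores are concave distortion risk measures): a core `Ψ` satisfies (B2), (B4), (C1),
(C2) and (C5) iff it is the Choquet integral with respect to `h ∘ P` for an increasing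
concave distortion `h` with `h(0) = 0` and `h(1) = 1`. -/
theorem distortion_characterization_ambiguity_sensitive {Ω : Type*} [MeasurableSpace Ω]
    (Ψ : (Ω → ℝ) → Measure Ω → ℝ) :
    ((∀ X Y : Ω → ℝ, BddMeas X → BddMeas Y → ∀ P : Measure Ω, IsAtomlessProb P →
        P.map X = P.map Y → Ψ X P = Ψ Y P) ∧
      (∀ X : Ω → ℝ, BddMeas X → ∀ P Q : Measure Ω, IsAtomlessProb P → IsAtomlessProb Q →
        ∀ l : ℝ, l ∈ Icc (0:ℝ) 1 →
        l * Ψ X P + (1 - l) * Ψ X Q ≤ Ψ X (mixM l P Q)) ∧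
      (∀ A : Set Ω, MeasurableSet A → ∀ P Q : Measure Ω, IsAtomlessProb P →
        IsAtomlessProb Q → P A = Q A → ∀ l : ℝ, l ∈ Icc (0:ℝ) 1 →
        Ψ (A.indicator fun _ => (1:ℝ)) (mixM l P Q) =
          l * Ψ (A.indicator fun _ => (1:ℝ)) P + (1 - l) * Ψ (A.indicator fun _ => (1:ℝ)) Q) ∧
      (∀ X Y : Ω → ℝ, BddMeas X → BddMeas Y → ∀ P : Measure Ω, IsAtomlessProb P →
        (∀ ω, X ω ≤ Y ω) → Ψ X P ≤ Ψ Y P) ∧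
      (∀ X : Ω → ℝ, BddMeas X → ∀ P : Measure Ω, IsAtomlessProb P → ∀ m : ℝ,
        Ψ (fun ω => X ω + m) P = Ψ X P + m) ∧
      (∀ X Y : Ω → ℝ, BddMeas X → BddMeas Y → ∀ P : Measure Ω, IsAtomlessProb P →
        Comonotone X Y → Ψ (fun ω => X ω + Y ω) P = Ψ X P + Ψ Y P))
    ↔
    (∃ h : ℝ → ℝ, MonotoneOn h (Icc (0:ℝ) 1) ∧ ConcaveOn ℝ (Icc (0:ℝ) 1) h ∧
      h 0 = 0 ∧ h 1 = 1 ∧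
      ∀ X : Ω → ℝ, BddMeas X → ∀ P : Measure Ω, IsAtomlessProb P →
        Ψ X P = choquet h P X) := by
  constructor
  · rintro ⟨h1, h2, h3, h4, h5, h6⟩
    have hΨ : IsSensitiveCore Ψ := ⟨h1, h2, h3, fun P hP =>
      ⟨fun X Y hX hY hXY => h4 X Y hX hY P hP hXY, fun X hX m => h5 X hX P hP m,
        fun X Y hX hY hXY => h6 X Y hX hY P hP hXY⟩⟩
    by_cases hne : ∃ P : Measure Ω, IsAtomlessProb P
    · obtain ⟨P, hP⟩ := hne
      obtain ⟨h, hh, hr⟩ := hΨ.exists_represents hP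
      exact ⟨h, hh.mono, hΨ.concaveOn hP hr, hh.zero, hh.one, fun X hX Q hQ =>
        hΨ.eq_choquet hQ hh (hΨ.represents_of_represents hP hQ hr) hX⟩
    · exact ⟨id, monotoneOn_id, concaveOn_id (convex_Icc _ _), rfl, rfl,
        fun X _ P hP => absurd ⟨P, hP⟩ hne⟩
  · rintro ⟨h, hmono, hconc, h0, h1, hΨ⟩
    have hh : IsDistortion h := ⟨hmono, h0, h1⟩
    have hI : ∀ P : Measure Ω, IsAtomlessProb P → IsComonotoneMonetary (choquet h P) :=
      fun P hP => by
        have := hP.1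
        exact hh.isComonotoneMonetary_choquet
    refine ⟨fun X Y hX hY P hP hXY => ?_, fun X hX P Q hP hQ l hl => ?_,
      fun A hA P Q hP hQ hPQ l hl => ?_, fun X Y hX hY P hP hXY => ?_,
      fun X hX P hP m => ?_, fun X Y hX hY P hP hXY => ?_⟩
    · rw [hΨ X hX P hP, hΨ Y hY P hP, IsDistortion.choquet_congr_law hX.1 hY.1 hXY]
    · have := hP.1
      rw [hΨ X hX P hP, hΨ X hX Q hQ, hΨ X hX _ (hP.mixM hQ hl)]
      exact hh.choquet_mixM hconc hP hQ hl hX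
    · have := hP.1
      have := hQ.1
      have := (hP.mixM hQ hl).1
      have hX := bddMeas_indicator hA
      rw [hΨ _ hX P hP, hΨ _ hX Q hQ, hΨ _ hX _ (hP.mixM hQ hl), hh.choquet_indicator,
        hh.choquet_indicator, hh.choquet_indicator, mixM_real_apply hl, Measure.real,
        Measure.real, hPQ, ← add_mul, ← add_mul, add_sub_cancel, one_mul, one_mul]
    · rw [hΨ X hX P hP, hΨ Y hY P hP]
      exact (hI P hP).mono X Y hX hY hXY
    · rw [hΨ X hX P hP, hΨ _ (hX.add (bddMeas_const m)) P hP]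
      exact (hI P hP).cash X hX m
    · rw [hΨ X hX P hP, hΨ Y hY P hP, hΨ _ (hX.add hY) P hP]
      exact (hI P hP).comon X Y hX hY hXY
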